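/- arXiv:1701.09163 — 2 statements merged into one kernel-verified Lean document; each statement's English description precedes it below -/
import Mathlib

section
/- Let α be an irrational real number and N a positive integer. Then the discrepancy D_N = sup_{0≤a<b≤1} | (1/N) · #{1 ≤ n ≤ N : {(n−α)²/(2N)} ∈ [a,b]} − (b−a) | satisfies D_N = O( log N · (√(log N) + τ(N)) / √N ), where τ(N) is the number of divisors of N and the implied constant is independent of α. -/
open Finset

lemma vdc_aux (z : ℕ → ℂ) (N : ℕ) :
    ‖∑ n ∈ range N, z n‖ ^ 2 + ∑ n ∈ range N, ‖z n‖ ^ 2 =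
      2 * (∑ n ∈ range N, ∑ m ∈ range (n + 1), z n * (starRingEnd ℂ) (z m)).re := by
  induction N with
  | zero => simp
  | succ N ih =>
    rw [sum_range_succ, sum_range_succ, sum_range_succ (fun n => ∑ m ∈ range (n + 1), z n * (starRingEnd ℂ) (z m)), Complex.add_re, mul_add, ← ih]
    rw [← mul_sum, ← map_sum, sum_range_succ _ N]
    generalize ∑ n ∈ range N, z n = S
    simp only [← Complex.normSq_eq_norm_sq, Complex.normSq_apply, Complex.add_re, Complex.add_im, Complex.mul_re, Complex.conj_re, Complex.conj_im]
    ring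

lemma vdc (z : ℕ → ℂ) (N : ℕ) :
    ‖∑ n ∈ range N, z n‖ ^ 2 ≤
      2 * ∑ k ∈ range N, ‖∑ m ∈ range (N - k), z (m + k) * (starRingEnd ℂ) (z m)‖ := by
  have h1 := vdc_aux z N
  have h2 : ∑ n ∈ range N, ∑ m ∈ range (n + 1), z n * (starRingEnd ℂ) (z m) =
      ∑ k ∈ range N, ∑ m ∈ range (N - k), z (m + k) * (starRingEnd ℂ) (z m) := by
    rw [← Finset.sum_range_diag_flip N (fun k m => z (m + k) * (starRingEnd ℂ) (z m))]
    refine sum_congr rfl fun n _ => ?_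
    rw [← Finset.sum_flip]
    refine sum_congr rfl fun k hk => ?_
    have : n - k + k = n := by have := mem_range.1 hk; omega
    rw [this]
  rw [h2] at h1
  have h3 : 0 ≤ ∑ n ∈ range N, ‖z n‖ ^ 2 := sum_nonneg fun _ _ => by positivity
  have h4 := Complex.re_le_norm (∑ k ∈ range N, ∑ m ∈ range (N - k), z (m + k) * (starRingEnd ℂ) (z m))
  have h5 := norm_sum_le (range N) (fun k => ∑ m ∈ range (N - k), z (m + k) * (starRingEnd ℂ) (z m))
  linarith

noncomputable def ee (t : ℝ) : ℂ := Complex.exp (((2 * Real.pi * t : ℝ) : ℂ) * Complex.I)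

lemma ee_add (s t : ℝ) : ee (s + t) = ee s * ee t := by
  rw [ee, ee, ee, ← Complex.exp_add]; congr 1; push_cast; ring

lemma norm_ee (t : ℝ) : ‖ee t‖ = 1 := Complex.norm_exp_ofReal_mul_I _

lemma conj_ee (t : ℝ) : (starRingEnd ℂ) (ee t) = ee (-t) := by
  rw [ee, ee, ← Complex.exp_conj]; congr 1
  simp only [map_mul, Complex.conj_ofReal, Complex.conj_I]; push_cast; ring

lemma ee_pow (t : ℝ) (m : ℕ) : ee t ^ m = ee (m * t) := by
  rw [ee, ee, ← Complex.exp_nat_mul]; congr 1; push_cast; ring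

lemma ee_nat (n : ℕ) : ee n = 1 := by
  rw [ee, Complex.exp_eq_one_iff]; exact ⟨n, by push_cast; ring⟩

lemma ee_re (t : ℝ) : (ee t).re = Real.cos (2 * Real.pi * t) := Complex.exp_ofReal_mul_I_re _

lemma norm_ee_sub_one (t : ℝ) : ‖ee t - 1‖ = |2 * Real.sin (Real.pi * t)| := by
  have := Complex.norm_exp_I_mul_ofReal_sub_one (2 * Real.pi * t)
  rw [ee, mul_comm, this, Real.norm_eq_abs]; congr 3; ring

lemma geom_bound (t : ℝ) (h0 : 0 < t) (h1 : t < 1) (L : ℕ) :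
    ‖∑ m ∈ range L, ee t ^ m‖ ≤ 1 / 2 * (1 / t + 1 / (1 - t)) := by
  have hs : 2 * (t * (1 - t)) ≤ Real.sin (Real.pi * t) := by
    have hpi := Real.pi_pos
    rcases le_total t (1/2) with h | h
    · have := Real.mul_le_sin (x := Real.pi * t) (by positivity) (by nlinarith)
      have e : 2 / Real.pi * (Real.pi * t) = 2 * t := by field_simp
      nlinarith
    · have := Real.mul_le_sin (x := Real.pi * (1 - t)) (mul_nonneg hpi.le (by linarith)) (by nlinarith)
      have e : 2 / Real.pi * (Real.pi * (1 - t)) = 2 * (1 - t) := by field_simp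
      have e2 : Real.sin (Real.pi * (1 - t)) = Real.sin (Real.pi * t) := by
        rw [← Real.sin_pi_sub]; congr 1; ring
      nlinarith
  have hpos : 0 < t * (1 - t) := mul_pos h0 (by linarith)
  have hn : 4 * (t * (1 - t)) ≤ ‖ee t - 1‖ := by
    rw [norm_ee_sub_one]; refine le_trans ?_ (le_abs_self _); linarith
  have hne : ee t ≠ 1 := by
    intro h; rw [h] at hn; simp at hn; linarith
  rw [geom_sum_eq hne, norm_div]
  have h2 : ‖ee t ^ L - 1‖ ≤ 2 := by
    refine (norm_sub_le _ _).trans ?_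
    rw [norm_pow, norm_ee]; norm_num
  calc _ ≤ 2 / (4 * (t * (1 - t))) := by gcongr
    _ = _ := by have : 1 - t ≠ 0 := by linarith
                field_simp; ring

lemma sum_per (F : ℕ → ℝ) (M : ℕ) (hF : ∀ k, F (k + M) = F k) (d : ℕ) :
    ∑ k ∈ range (d * M), F k = d * ∑ k ∈ range M, F k := by
  induction d with
  | zero => simp
  | succ d ih =>
    rw [add_mul, one_mul, sum_range_add, ih]
    have : ∀ k, F (d * M + k) = F k := by
      intro k
      have := Function.Periodic.nat_mul (f := F) (c := M) hF d k
      rw [← this]; congr 1; simp [add_comm]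
    simp only [this]; push_cast; ring

lemma sum_mulmod (G : ℕ → ℝ) (M h : ℕ) (hM : 0 < M) (hc : Nat.Coprime M h) :
    ∑ k ∈ range M, G (h * k % M) = ∑ r ∈ range M, G r := by
  have hmaps : Set.MapsTo (fun k => h * k % M) (range M) (range M) := fun k _ => by
    simpa using Nat.mod_lt _ hM
  have hinj : Set.InjOn (fun k => h * k % M) (range M) := by
    intro a ha b hb hab
    have : h * a ≡ h * b [MOD M] := hab
    have := Nat.ModEq.cancel_left_of_coprime hc this
    simp at ha hb
    exact Nat.ModEq.eq_of_lt_of_lt this ha hb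
  exact sum_nbij (fun k => h * k % M) hmaps hinj (surjOn_of_injOn_of_card_le _ hmaps hinj le_rfl) (fun _ _ => rfl)

lemma harm_bound (M : ℕ) : ∑ r ∈ range M, (1 : ℝ) / ((r : ℝ) + 1) ≤ 1 + Real.log M := by
  have := harmonic_le_one_add_log M
  simpa [harmonic] using this

lemma sumG (M : ℕ) (hM : 0 < M) (N : ℝ) :
    ∑ r ∈ range M, (if r = 0 then N else 1 / 2 * (1 / ((r : ℝ) / M) + 1 / (1 - (r : ℝ) / M)))
      ≤ N + M * (1 + Real.log M) := by
  obtain ⟨K, rfl⟩ : ∃ K, M = K + 1 := ⟨M - 1, by omega⟩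
  rw [sum_range_succ']
  simp only [Nat.add_eq_zero_iff, one_ne_zero, and_false, if_false, if_true]
  rw [add_comm]
  gcongr
  have e : ∀ r ∈ range K, 1 / 2 * (1 / (((r + 1 : ℕ) : ℝ) / (K + 1 : ℕ)) + 1 / (1 - ((r + 1 : ℕ) : ℝ) / (K + 1 : ℕ)))
      = 1 / 2 * ((K + 1) * (1 / ((r : ℝ) + 1)) + (K + 1) * (1 / (((K - 1 - r : ℕ) : ℝ) + 1))) := by
    intro r hr
    have hr := mem_range.1 hr
    have : ((K - 1 - r : ℕ) : ℝ) + 1 = K - r := by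
      rw [eq_sub_iff_add_eq]; norm_cast; omega
    have h1 : (K : ℝ) - r ≠ 0 := by
      have : (r : ℝ) < K := by exact_mod_cast hr
      linarith
    have h2 : 1 - ((r : ℝ) + 1) / ((K : ℝ) + 1) = (K - r) / (K + 1) := by field_simp; ring
    rw [this]; push_cast; rw [h2]; field_simp
  rw [sum_congr rfl e, ← mul_sum, sum_add_distrib, ← mul_sum, ← mul_sum,
    sum_range_reflect (fun r => 1 / ((r : ℝ) + 1)) K]
  have hb := harm_bound (K + 1)
  rw [sum_range_succ] at hb
  have : (0 : ℝ) ≤ 1 / ((K : ℝ) + 1) := by positivity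
  have : ∑ r ∈ range K, 1 / ((r : ℝ) + 1) ≤ 1 + Real.log (K + 1 : ℕ) := by linarith
  calc _ = ((K + 1 : ℕ) : ℝ) * ∑ r ∈ range K, 1 / ((r : ℝ) + 1) := by push_cast; ring
    _ ≤ _ := by gcongr

lemma sumB (h N : ℕ) (hN : 0 < N) :
    ∑ k ∈ range N, ‖∑ m ∈ range (N - k), ee ((h * k : ℕ) / (N : ℝ)) ^ m‖
      ≤ Nat.gcd h N * N + N * (1 + Real.log N) := by
  obtain ⟨d, h', M, hd, hcop, rfl, rfl⟩ : ∃ d h' M, 0 < d ∧ Nat.Coprime h' M ∧ h = h' * d ∧ N = M * d := by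
    have hg := Nat.gcd_pos_of_pos_right h hN
    obtain ⟨h', M, a, b, c⟩ := Nat.exists_coprime h N
    exact ⟨_, h', M, hg, a, b, c⟩
  have hM : 0 < M := Nat.pos_of_mul_pos_right hN
  have hg : Nat.gcd (h' * d) (M * d) = d := by rw [Nat.gcd_mul_right, hcop.gcd_eq_one, one_mul]
  rw [hg]
  set G : ℕ → ℝ := fun r => if r = 0 then ((M * d : ℕ) : ℝ) else 1 / 2 * (1 / ((r : ℝ) / M) + 1 / (1 - (r : ℝ) / M)) with hG
  have hb : ∀ k ∈ range (M * d), ‖∑ m ∈ range (M * d - k), ee ((h' * d * k : ℕ) / ((M * d : ℕ) : ℝ)) ^ m‖ ≤ G (h' * k % M) := by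
    intro k _
    have e : ee ((h' * d * k : ℕ) / ((M * d : ℕ) : ℝ)) = ee ((h' * k % M : ℕ) / (M : ℝ)) := by
      have e1 : (h' * d * k : ℕ) / ((M * d : ℕ) : ℝ) = (h' * k % M : ℕ) / (M : ℝ) + (h' * k / M : ℕ) := by
        have : ((h' * k : ℕ) : ℝ) = (M : ℝ) * (h' * k / M : ℕ) + (h' * k % M : ℕ) := by
          exact_mod_cast (Nat.div_add_mod (h' * k) M).symm
        have hM' : (M : ℝ) ≠ 0 := by positivity
        have hd' : (d : ℝ) ≠ 0 := by positivity
        rw [div_add' _ _ _ hM', div_eq_div_iff (by positivity) hM']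
        push_cast at this ⊢
        linear_combination (d : ℝ) * M * this
      rw [e1, ee_add, ee_nat, mul_one]
    rw [e, hG]
    dsimp only
    split_ifs with h0
    · refine (norm_sum_le _ _).trans ?_
      simp only [norm_pow, norm_ee, one_pow, sum_const, card_range, nsmul_eq_mul, mul_one]
      exact_mod_cast Nat.sub_le _ _
    · apply geom_bound
      · have := Nat.pos_of_ne_zero h0
        positivity
      · rw [div_lt_one (by positivity)]
        exact_mod_cast Nat.mod_lt _ hM
  refine (sum_le_sum hb).trans ?_
  rw [mul_comm M d, sum_per (fun k => G (h' * k % M)) M (by intro k; simp [mul_add]) d, sum_mulmod G M h' hM hcop.symm]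
  have h1 := sumG M hM ((M * d : ℕ) : ℝ)
  have h2 : Real.log M ≤ Real.log (d * M : ℕ) := by
    apply Real.log_le_log (by positivity)
    exact_mod_cast Nat.le_mul_of_pos_left M hd
  calc (d : ℝ) * ∑ r ∈ range M, G r ≤ d * (((M * d : ℕ) : ℝ) + M * (1 + Real.log M)) := by
        gcongr
    _ ≤ d * (((M * d : ℕ) : ℝ) + M * (1 + Real.log (d * M : ℕ))) := by gcongr
    _ = _ := by push_cast; ring

lemma S_sq (α : ℝ) (h N : ℕ) (hN : 0 < N) :
    ‖∑ n ∈ range N, ee (h * ((((n + 1 : ℕ) : ℝ) - α) ^ 2 / (2 * N)))‖ ^ 2 ≤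
      2 * (Nat.gcd h N * N + N * (1 + Real.log N)) := by
  refine (vdc _ N).trans ?_
  refine le_trans (le_of_eq ?_) (mul_le_mul_of_nonneg_left (sumB h N hN) (by norm_num))
  congr 1
  refine sum_congr rfl fun k _ => ?_
  have : ∀ m ∈ range (N - k), ee (h * ((((m + k + 1 : ℕ) : ℝ) - α) ^ 2 / (2 * N))) *
      (starRingEnd ℂ) (ee (h * ((((m + 1 : ℕ) : ℝ) - α) ^ 2 / (2 * N)))) =
      ee (h * (k * (2 * (1 - α) + k)) / (2 * N)) * ee ((h * k : ℕ) / (N : ℝ)) ^ m := by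
    intro m _
    rw [conj_ee, ← ee_add, ee_pow, ← ee_add]
    congr 1
    have : (N : ℝ) ≠ 0 := by positivity
    push_cast
    field_simp
    ring
  rw [sum_congr rfl this, ← mul_sum, norm_mul, norm_ee, one_mul]

lemma S_bound (α : ℝ) (h N : ℕ) (hN : 2 ≤ N) :
    ‖∑ n ∈ range N, ee (h * ((((n + 1 : ℕ) : ℝ) - α) ^ 2 / (2 * N)))‖ ≤
      3 * √N * (√(Nat.gcd h N) + √(Real.log N)) := by
  have hl : Real.log 2 ≤ Real.log N := Real.log_le_log (by norm_num) (by exact_mod_cast hN)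
  have hl2 := Real.log_two_gt_d9
  have h1 := S_sq α h N (by omega)
  refine abs_le_of_sq_le_sq' (h1.trans ?_) (by positivity) |>.2
  have a := Real.sq_sqrt (show (0:ℝ) ≤ N by positivity)
  have b := Real.sq_sqrt (show (0:ℝ) ≤ Nat.gcd h N by positivity)
  have c := Real.sq_sqrt (show (0:ℝ) ≤ Real.log N by linarith)
  have e : (3 * √N * (√(Nat.gcd h N) + √(Real.log N)))^2 = 9 * N * (Nat.gcd h N + Real.log N + 2 * √(Nat.gcd h N) * √(Real.log N)) := by
    rw [mul_pow, mul_pow, a, add_sq, b, c]; ring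
  rw [e]
  have : 0 ≤ √(Nat.gcd h N) * √(Real.log N) := by positivity
  have hN' : (0:ℝ) < N := by positivity
  have hg : (0:ℝ) ≤ Nat.gcd h N := by positivity
  nlinarith [mul_nonneg hN'.le this, mul_nonneg hN'.le hg, mul_le_mul_of_nonneg_left hl hN'.le, mul_le_mul_of_nonneg_left hl2.le hN'.le]

noncomputable def ff (y : ℝ) : ℝ := (Int.fract y ^ 2 - Int.fract y + 6⁻¹) / 2

lemma ff_ser (y : ℝ) :
    HasSum (fun h : ℕ => 1 / (h : ℝ) ^ 2 * Real.cos (2 * Real.pi * (h * y))) (2 * Real.pi ^ 2 * ff y) := by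
  have h1 := hasSum_one_div_nat_pow_mul_cos (k := 1) one_ne_zero (x := Int.fract y)
    ⟨Int.fract_nonneg y, (Int.fract_lt_one y).le⟩
  have h2 : (Polynomial.map (algebraMap ℚ ℝ) (Polynomial.bernoulli (2 * 1))).eval (Int.fract y)
    = Int.fract y ^ 2 - Int.fract y + 6⁻¹ := bernoulliFun_two _
  rw [h2] at h1
  convert h1 using 1
  · ext h
    congr 1
    have : 2 * Real.pi * (h * y) = 2 * Real.pi * h * Int.fract y + ((h * ⌊y⌋ : ℤ) : ℝ) * (2 * Real.pi) := by
      have := Int.floor_add_fract y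
      push_cast
      linear_combination (-2 * Real.pi * h) * this
    rw [this, Real.cos_add_int_mul_two_pi]
  · rw [ff]; norm_num; ring

lemma ff_up (y δ : ℝ) (h0 : 0 < δ) (h1 : δ < 1) :
    ff (y + δ) - ff y ≤ δ * (Int.fract y - 1 / 2) + δ ^ 2 / 2 := by
  have a := Int.fract_nonneg y
  have b := Int.fract_lt_one y
  have e := Int.floor_add_fract y
  unfold ff
  rcases lt_or_ge (Int.fract y + δ) 1 with h | h
  · have : Int.fract (y + δ) = Int.fract y + δ := by
      rw [Int.fract_eq_iff]; exact ⟨by linarith, h, ⌊y⌋, by linarith⟩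
    rw [this]; nlinarith
  · have : Int.fract (y + δ) = Int.fract y + δ - 1 := by
      rw [Int.fract_eq_iff]; exact ⟨by linarith, by linarith, ⌊y⌋ + 1, by push_cast; linarith⟩
    rw [this]; nlinarith

lemma ff_down (y δ : ℝ) (h0 : 0 < δ) (h1 : δ < 1) :
    δ * (Int.fract y - 1 / 2) - δ ^ 2 / 2 ≤ ff y - ff (y - δ) := by
  have a := Int.fract_nonneg y
  have b := Int.fract_lt_one y
  have e := Int.floor_add_fract y
  unfold ff
  rcases lt_or_ge (Int.fract y - δ) 0 with h | h
  · have : Int.fract (y - δ) = Int.fract y - δ + 1 := by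
      rw [Int.fract_eq_iff]; exact ⟨by linarith, by linarith, ⌊y⌋ - 1, by push_cast; linarith⟩
    rw [this]; nlinarith
  · have : Int.fract (y - δ) = Int.fract y - δ := by
      rw [Int.fract_eq_iff]; exact ⟨by linarith, by linarith, ⌊y⌋, by linarith⟩
    rw [this]; nlinarith

noncomputable def uu (N : ℕ) (h : ℕ) : ℝ := min (1 / (h : ℝ)) (N / (h : ℝ) ^ 2)

lemma uu_nonneg (N h : ℕ) : 0 ≤ uu N h := by unfold uu; positivity

lemma uu_mul (N e j : ℕ) (he : 0 < e) : √e * uu N (e * j) ≤ uu N j := by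
  have h1 : (1 : ℝ) ≤ e := by exact_mod_cast he
  have h2 : √(e : ℝ) ≤ e := by
    rw [Real.sqrt_le_left (by positivity)]; nlinarith
  have h3 : uu N (e * j) ≤ 1 / e * uu N j := by
    unfold uu
    rw [mul_min_of_nonneg _ _ (by positivity)]
    apply min_le_min
    · push_cast; rw [one_div_mul_one_div]
    · push_cast
      rw [mul_pow, ← div_div, mul_comm (1 / (e : ℝ)), mul_one_div, div_right_comm]
      gcongr
      nlinarith
  have h4 := uu_nonneg N j
  calc _ ≤ (e : ℝ) * (1 / e * uu N j) := by
        apply mul_le_mul h2 h3 (uu_nonneg _ _) (by positivity)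
    _ = uu N j := by field_simp

lemma uu_sum (N : ℕ) (hN : 2 ≤ N) (m : ℕ) : ∑ h ∈ range m, uu N h ≤ 4 * Real.log N := by
  have hl : Real.log 2 ≤ Real.log N := Real.log_le_log (by norm_num) (by exact_mod_cast hN)
  have hl2 := Real.log_two_gt_d9
  set K := max N m with hK
  have s1 : ∑ h ∈ range m, uu N h ≤ ∑ h ∈ range (K + 1), uu N h :=
    sum_le_sum_of_subset_of_nonneg (range_mono (by omega)) fun _ _ _ => uu_nonneg _ _
  have s2 : ∑ h ∈ range (K + 1), uu N h ≤ ∑ h ∈ range (N + 1), uu N h + ∑ h ∈ Ioc N K, uu N h := by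
    rw [← sum_union]
    · refine sum_le_sum_of_subset_of_nonneg ?_ fun _ _ _ => uu_nonneg _ _
      intro x; simp only [mem_range, mem_union, mem_Ioc]; omega
    · rw [disjoint_left]; intro x; simp only [mem_range, mem_Ioc]; omega
  have s3 : ∑ h ∈ range (N + 1), uu N h ≤ 1 + Real.log N := by
    rw [sum_range_succ']
    refine le_trans ?_ (harm_bound N)
    have : uu N 0 = 0 := by simp [uu]
    rw [this, add_zero]
    refine sum_le_sum fun h _ => ?_
    refine (min_le_left _ _).trans ?_
    push_cast; rfl
  have s4 : ∑ h ∈ Ioc N K, uu N h ≤ 1 := by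
    calc _ ≤ ∑ h ∈ Ioc N K, (N : ℝ) * ((h : ℝ) ^ 2)⁻¹ := sum_le_sum fun h _ => min_le_right _ _
      _ ≤ N * ((N : ℝ)⁻¹ - (K : ℝ)⁻¹) := by
        rw [← mul_sum]; gcongr; exact sum_Ioc_inv_sq_le_sub (by omega) (le_max_left _ _)
      _ ≤ N * (N : ℝ)⁻¹ := by gcongr; simp
      _ = 1 := mul_inv_cancel₀ (by positivity)
  linarith

lemma gcd_sum (N : ℕ) (hN : 2 ≤ N) (m : ℕ) :
    ∑ h ∈ range m, √(Nat.gcd h N : ℝ) * uu N h ≤ (Nat.divisors N).card * (4 * Real.log N) := by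
  have h1 : ∀ h ∈ range m, √(Nat.gcd h N : ℝ) * uu N h ≤
      ∑ e ∈ Nat.divisors N, if e ∣ h then √(e : ℝ) * uu N h else 0 := by
    intro h _
    have := single_le_sum (f := fun e : ℕ => if e ∣ h then √(e : ℝ) * uu N h else 0)
      (s := Nat.divisors N) (fun e _ => by
        split_ifs
        · exact mul_nonneg (Real.sqrt_nonneg _) (uu_nonneg _ _)
        · rfl) (Nat.mem_divisors.2 ⟨Nat.gcd_dvd_right h N, by omega⟩)
    simpa [Nat.gcd_dvd_left] using this
  refine (sum_le_sum h1).trans ?_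
  rw [sum_comm, ← nsmul_eq_mul]
  refine sum_le_card_nsmul _ _ _ fun e he => ?_
  have he0 : 0 < e := Nat.pos_of_mem_divisors he
  rw [← sum_filter]
  refine le_trans ?_ (uu_sum N hN m)
  calc ∑ h ∈ range m with e ∣ h, √(e : ℝ) * uu N h
      ≤ ∑ h ∈ (range m).image (e * ·), √(e : ℝ) * uu N h := by
        refine sum_le_sum_of_subset_of_nonneg ?_ fun _ _ _ => mul_nonneg (Real.sqrt_nonneg _) (uu_nonneg _ _)
        intro h hh
        obtain ⟨h2, j, rfl⟩ := mem_filter.1 hh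
        refine mem_image.2 ⟨j, ?_, rfl⟩
        rw [mem_range] at h2 ⊢
        nlinarith
    _ = ∑ j ∈ range m, √(e : ℝ) * uu N (e * j) := by
        rw [sum_image]
        intro a _ b _ hab
        exact Nat.eq_of_mul_eq_mul_left he0 hab
    _ ≤ _ := sum_le_sum fun j _ => uu_mul N e j he0

lemma ee_sub_bound (h N : ℕ) (hN : 0 < N) (s t : ℝ) (hst : |s - t| = 1 / N) :
    1 / (h : ℝ) ^ 2 * ‖ee (h * s) - ee (h * t)‖ ≤ 2 * Real.pi / N * uu N h := by
  rcases Nat.eq_zero_or_pos h with rfl | hh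
  · simp [uu]
  have e : ‖ee (h * s) - ee (h * t)‖ = ‖ee (h * (s - t)) - 1‖ := by
    have : ee (h * s) - ee (h * t) = ee (h * t) * (ee (h * (s - t)) - 1) := by
      rw [mul_sub, mul_one, ← ee_add]; congr 2; ring
    rw [this, norm_mul, norm_ee, one_mul]
  have b1 : ‖ee (h * s) - ee (h * t)‖ ≤ 2 := by
    refine (norm_sub_le _ _).trans ?_
    rw [norm_ee, norm_ee]; norm_num
  have b2 : ‖ee (h * s) - ee (h * t)‖ ≤ 2 * Real.pi * h / N := by
    rw [e, norm_ee_sub_one, abs_mul]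
    have := Real.abs_sin_le_abs (x := Real.pi * (h * (s - t)))
    rw [abs_mul, abs_mul, hst, abs_of_pos Real.pi_pos, Nat.abs_cast] at this
    calc _ ≤ |(2:ℝ)| * (Real.pi * (h * (1 / N))) := by gcongr
      _ = _ := by rw [abs_of_pos (by norm_num : (0:ℝ) < 2)]; ring
  have hN' : (0:ℝ) < N := by positivity
  have hh' : (0:ℝ) < h := by positivity
  unfold uu
  rw [mul_min_of_nonneg _ _ (by positivity)]
  apply le_min
  · calc _ ≤ 1 / (h : ℝ) ^ 2 * (2 * Real.pi * h / N) := by gcongr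
      _ = _ := by field_simp
  · calc _ ≤ 1 / (h : ℝ) ^ 2 * (2 * Real.pi) := by
          gcongr; linarith [Real.pi_gt_three]
      _ = _ := by field_simp

lemma ff_diff (α : ℝ) (N : ℕ) (hN : 2 ≤ N) (s t : ℝ) (hst : |s - t| = 1 / N) :
    |∑ n ∈ range N, (ff ((((n + 1 : ℕ) : ℝ) - α) ^ 2 / (2 * N) + s) -
        ff ((((n + 1 : ℕ) : ℝ) - α) ^ 2 / (2 * N) + t))| ≤
      4 * (Real.log N * (√(Real.log N) + (Nat.divisors N).card)) / √N := by
  set x : ℕ → ℝ := fun n => (((n + 1 : ℕ) : ℝ) - α) ^ 2 / (2 * N) with hx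
  set Q := Real.log N * (√(Real.log N) + (Nat.divisors N).card) with hQ
  have hN' : (0:ℝ) < N := by positivity
  have hs : HasSum (fun h : ℕ => ∑ n ∈ range N, (1 / (h : ℝ) ^ 2 * Real.cos (2 * Real.pi * (h * (x n + s)))
      - 1 / (h : ℝ) ^ 2 * Real.cos (2 * Real.pi * (h * (x n + t)))))
      (∑ n ∈ range N, (2 * Real.pi ^ 2 * ff (x n + s) - 2 * Real.pi ^ 2 * ff (x n + t))) :=
    hasSum_sum fun n _ => (ff_ser _).sub (ff_ser _)
  have hterm : ∀ h : ℕ, |∑ n ∈ range N, (1 / (h : ℝ) ^ 2 * Real.cos (2 * Real.pi * (h * (x n + s)))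
      - 1 / (h : ℝ) ^ 2 * Real.cos (2 * Real.pi * (h * (x n + t))))| ≤
      6 * Real.pi / √N * (√(Nat.gcd h N : ℝ) * uu N h + √(Real.log N) * uu N h) := by
    intro h
    have e : ∑ n ∈ range N, (1 / (h : ℝ) ^ 2 * Real.cos (2 * Real.pi * (h * (x n + s)))
      - 1 / (h : ℝ) ^ 2 * Real.cos (2 * Real.pi * (h * (x n + t)))) =
        1 / (h : ℝ) ^ 2 * ((∑ n ∈ range N, ee (h * x n)) * (ee (h * s) - ee (h * t))).re := by
      rw [sum_mul, Complex.re_sum, mul_sum]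
      refine sum_congr rfl fun n _ => ?_
      rw [mul_sub, ← ee_add, ← ee_add, Complex.sub_re, ee_re, ee_re, mul_add (h : ℝ), mul_add (h : ℝ), mul_sub]
    rw [e, abs_mul, abs_of_nonneg (by positivity)]
    have h1 := Complex.abs_re_le_norm ((∑ n ∈ range N, ee (h * x n)) * (ee (h * s) - ee (h * t)))
    rw [norm_mul] at h1
    have h2 := S_bound α h N hN
    have h3 := ee_sub_bound h N (by omega) s t hst
    calc _ ≤ 1 / (h : ℝ) ^ 2 * (‖∑ n ∈ range N, ee (h * x n)‖ * ‖ee (h * s) - ee (h * t)‖) := by gcongr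
      _ = ‖∑ n ∈ range N, ee (h * x n)‖ * (1 / (h : ℝ) ^ 2 * ‖ee (h * s) - ee (h * t)‖) := by ring
      _ ≤ (3 * √N * (√(Nat.gcd h N) + √(Real.log N))) * (2 * Real.pi / N * uu N h) := by
        apply mul_le_mul h2 h3 (by positivity) (by positivity)
      _ = _ := by
        have : (N : ℝ) = √N * √N := (Real.mul_self_sqrt hN'.le).symm
        have hsq : √(N : ℝ) ≠ 0 := by positivity
        have e1 : √(N : ℝ) / N = 1 / √N := by rw [Real.sqrt_div_self']
        calc _ = 6 * Real.pi * (√(N : ℝ) / N) * (√(Nat.gcd h N : ℝ) * uu N h + √(Real.log N) * uu N h) := by ring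
          _ = _ := by rw [e1]; ring
  have hpart : ∀ m : ℕ, |∑ h ∈ range m, ∑ n ∈ range N, (1 / (h : ℝ) ^ 2 * Real.cos (2 * Real.pi * (h * (x n + s)))
      - 1 / (h : ℝ) ^ 2 * Real.cos (2 * Real.pi * (h * (x n + t))))| ≤ 24 * Real.pi / √N * Q := by
    intro m
    refine (abs_sum_le_sum_abs _ _).trans ((sum_le_sum fun h _ => hterm h).trans ?_)
    rw [← mul_sum, sum_add_distrib, ← mul_sum]
    have g1 := gcd_sum N hN m
    have g2 := mul_le_mul_of_nonneg_left (uu_sum N hN m) (Real.sqrt_nonneg (Real.log N))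
    calc _ ≤ 6 * Real.pi / √N * ((Nat.divisors N).card * (4 * Real.log N) + √(Real.log N) * (4 * Real.log N)) := by
          gcongr
      _ = _ := by rw [hQ]; ring
  have hlim := le_of_tendsto' hs.tendsto_sum_nat.abs hpart
  have e2 : ∑ n ∈ range N, (2 * Real.pi ^ 2 * ff (x n + s) - 2 * Real.pi ^ 2 * ff (x n + t)) =
      2 * Real.pi ^ 2 * ∑ n ∈ range N, (ff (x n + s) - ff (x n + t)) := by
    rw [mul_sum]; exact sum_congr rfl fun n _ => by ring
  rw [e2, abs_mul, abs_of_nonneg (by positivity)] at hlim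
  have hQ0 : 0 ≤ Q := by positivity
  have hpi := Real.pi_gt_three
  have h5 : 24 * Real.pi / √N * Q ≤ 2 * Real.pi ^ 2 * (4 * Q / √N) := by
    have : 0 ≤ Q / √N := by positivity
    calc _ = 24 * Real.pi * (Q / √N) := by ring
      _ ≤ 8 * Real.pi ^ 2 * (Q / √N) := by
          apply mul_le_mul_of_nonneg_right _ this
          nlinarith
      _ = _ := by ring
  exact le_of_mul_le_mul_left (hlim.trans h5) (by positivity)

lemma psi_bound (α : ℝ) (N : ℕ) (hN : 2 ≤ N) (c : ℝ) :
    |∑ n ∈ range N, (Int.fract ((((n + 1 : ℕ) : ℝ) - α) ^ 2 / (2 * N) - c) - 1 / 2)| ≤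
      1 / 2 + N * (4 * (Real.log N * (√(Real.log N) + (Nat.divisors N).card)) / √N) := by
  set x : ℕ → ℝ := fun n => (((n + 1 : ℕ) : ℝ) - α) ^ 2 / (2 * N) with hx
  have hN' : (0:ℝ) < N := by positivity
  have hN2 : (2:ℝ) ≤ N := by exact_mod_cast hN
  have hd0 : (0:ℝ) < 1 / N := by positivity
  have hd1 : 1 / (N:ℝ) < 1 := by rw [div_lt_one hN']; linarith
  have a1 := ff_diff α N hN (-c + 1 / N) (-c) (by rw [add_sub_cancel_left, abs_of_pos hd0])
  have a2 := ff_diff α N hN (-c) (-c - 1 / N) (by rw [sub_sub_cancel, abs_of_pos hd0])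
  have b1 : (N:ℝ) * ∑ n ∈ range N, (ff (x n + (-c + 1 / N)) - ff (x n + -c)) ≤
      ∑ n ∈ range N, (Int.fract (x n - c) - 1 / 2) + 1 / 2 := by
    have : ∑ n ∈ range N, (ff (x n + (-c + 1 / N)) - ff (x n + -c)) ≤
       ∑ n ∈ range N, (1 / N * (Int.fract (x n - c) - 1 / 2) + (1 / (N:ℝ)) ^ 2 / 2) := by
      refine sum_le_sum fun n _ => ?_
      rw [← add_assoc, ← sub_eq_add_neg]
      exact ff_up _ _ hd0 hd1
    rw [sum_add_distrib, ← mul_sum, sum_const, card_range, nsmul_eq_mul] at this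
    generalize ∑ n ∈ range N, (Int.fract (x n - c) - 1 / 2) = T at this ⊢
    refine (mul_le_mul_of_nonneg_left this hN'.le).trans (le_of_eq ?_)
    field_simp
  have b2 : ∑ n ∈ range N, (Int.fract (x n - c) - 1 / 2) - 1 / 2 ≤
      (N:ℝ) * ∑ n ∈ range N, (ff (x n + -c) - ff (x n + (-c - 1 / N))) := by
    have : ∑ n ∈ range N, (1 / N * (Int.fract (x n - c) - 1 / 2) - (1 / (N:ℝ)) ^ 2 / 2) ≤
       ∑ n ∈ range N, (ff (x n + -c) - ff (x n + (-c - 1 / N))) := by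
      refine sum_le_sum fun n _ => ?_
      rw [← add_sub_assoc, ← sub_eq_add_neg]
      exact ff_down _ _ hd0 hd1
    rw [sum_sub_distrib, ← mul_sum, sum_const, card_range, nsmul_eq_mul] at this
    generalize ∑ n ∈ range N, (Int.fract (x n - c) - 1 / 2) = T at this ⊢
    refine (le_of_eq ?_).trans (mul_le_mul_of_nonneg_left this hN'.le)
    field_simp
  have c1 := mul_le_mul_of_nonneg_left (abs_le.1 a1).1 hN'.le
  have c2 := mul_le_mul_of_nonneg_left (abs_le.1 a2).2 hN'.le
  rw [abs_le]
  constructor <;> linarith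

lemma ind_eq (x a b : ℝ) (ha : 0 ≤ a) (hab : a ≤ b) (hb : b ≤ 1) :
    (if a ≤ Int.fract x ∧ Int.fract x < b then (1:ℝ) else 0) =
      (b - a) + ((Int.fract (x - b) - 1 / 2) - (Int.fract (x - a) - 1 / 2)) := by
  have h0 := Int.fract_nonneg x
  have h1 := Int.fract_lt_one x
  have e := Int.floor_add_fract x
  have key : ∀ c, 0 ≤ c → c ≤ 1 → Int.fract (x - c) = if Int.fract x < c then Int.fract x - c + 1 else Int.fract x - c := by
    intro c hc0 hc1
    rw [Int.fract_eq_iff]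
    split_ifs with h
    · exact ⟨by linarith, by linarith, ⌊x⌋ - 1, by push_cast; linarith⟩
    · exact ⟨by linarith, by linarith, ⌊x⌋, by linarith⟩
  rw [key a ha (by linarith), key b (by linarith) hb]
  split_ifs <;> grind

lemma ico_bound (α : ℝ) (N : ℕ) (hN : 2 ≤ N) (a b : ℝ) (ha : 0 ≤ a) (hab : a ≤ b) (hb : b ≤ 1) :
    |(((Finset.Icc 1 N).filter (fun n : ℕ => a ≤ Int.fract (((n : ℝ) - α) ^ 2 / (2 * N)) ∧
        Int.fract (((n : ℝ) - α) ^ 2 / (2 * N)) < b)).card : ℝ) - N * (b - a)| ≤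
      1 + 8 * (N * ((Real.log N * (√(Real.log N) + (Nat.divisors N).card)) / √N)) := by
  have e : (((Finset.Icc 1 N).filter (fun n : ℕ => a ≤ Int.fract (((n : ℝ) - α) ^ 2 / (2 * N)) ∧
        Int.fract (((n : ℝ) - α) ^ 2 / (2 * N)) < b)).card : ℝ) - N * (b - a) =
      ∑ n ∈ range N, (Int.fract ((((n + 1 : ℕ) : ℝ) - α) ^ 2 / (2 * N) - b) - 1 / 2) -
      ∑ n ∈ range N, (Int.fract ((((n + 1 : ℕ) : ℝ) - α) ^ 2 / (2 * N) - a) - 1 / 2) := by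
    rw [card_filter, Nat.cast_sum, ← Finset.Ico_add_one_right_eq_Icc, sum_Ico_eq_sum_range, ← sum_sub_distrib]
    have : ∀ n ∈ range (N + 1 - 1), (((if a ≤ Int.fract ((((1 + n : ℕ) : ℝ) - α) ^ 2 / (2 * N)) ∧
        Int.fract ((((1 + n : ℕ) : ℝ) - α) ^ 2 / (2 * N)) < b then 1 else 0 : ℕ)) : ℝ) = (b - a) +
        ((Int.fract ((((n + 1 : ℕ) : ℝ) - α) ^ 2 / (2 * N) - b) - 1 / 2) -
      (Int.fract ((((n + 1 : ℕ) : ℝ) - α) ^ 2 / (2 * N) - a) - 1 / 2)) := by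
      intro n _
      rw [← ind_eq _ a b ha hab hb, add_comm 1 n]
      push_cast; rfl
    rw [sum_congr rfl this, sum_add_distrib, sum_const, Nat.add_sub_cancel, card_range, nsmul_eq_mul]
    ring
  rw [e]
  refine (abs_sub _ _).trans ?_
  have h1 := psi_bound α N hN a
  have h2 := psi_bound α N hN b
  refine (add_le_add h2 h1).trans (le_of_eq ?_)
  ring

/-- Discrepancy bound for the fractional parts of `(n-α)²/(2N)`, with implied
constant independent of the irrational `α`. -/
theorem discrepancy_bound :
    ∃ C : ℝ, 0 < C ∧ ∀ (α : ℝ), Irrational α → ∀ N : ℕ, 2 ≤ N →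
      ∀ a b : ℝ, 0 ≤ a → a < b → b ≤ 1 →
        |((Finset.Icc 1 N).filter
            (fun n : ℕ => Int.fract (((n : ℝ) - α) ^ 2 / (2 * N)) ∈ Set.Icc a b)).card / (N : ℝ)
          - (b - a)|
          ≤ C * Real.log N * (Real.sqrt (Real.log N) + (Nat.divisors N).card)
              / Real.sqrt N := by
  refine ⟨10, by norm_num, ?_⟩
  intro α _ N hN a b ha hab hb
  have hN' : (0:ℝ) < N := by positivity
  have hl : Real.log 2 ≤ Real.log N := Real.log_le_log (by norm_num) (by exact_mod_cast hN)
  have hl2 := Real.log_two_gt_d9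
  set R := (Real.log N * (√(Real.log N) + (Nat.divisors N).card)) / √N with hR
  have hNR : 1 ≤ N * R := by
    have hc : (2:ℝ) ≤ (Nat.divisors N).card := by
      have : ({1, N} : Finset ℕ) ⊆ Nat.divisors N := by
        intro x hx
        simp only [mem_insert, mem_singleton] at hx
        rcases hx with rfl | rfl <;> simp <;> omega
      have h2 := card_le_card this
      rw [card_pair (by omega)] at h2
      exact_mod_cast h2
    have hs : 1 ≤ √(N:ℝ) := by
      rw [Real.one_le_sqrt]; exact_mod_cast (by omega : 1 ≤ N)
    have hsl := Real.sqrt_nonneg (Real.log N)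
    have e : N * R = √N * (Real.log N * (√(Real.log N) + (Nat.divisors N).card)) := by
      rw [hR, mul_div_left_comm, Real.div_sqrt]; ring
    have : 1 ≤ Real.log N * (√(Real.log N) + (Nat.divisors N).card) := by nlinarith
    rw [e]; nlinarith
  set b' := min 1 (b + 1 / N) with hb'
  have hinv : (0:ℝ) < 1 / N := by positivity
  have hbb' : b ≤ b' := le_min hb (by linarith)
  have hb'2 : b' ≤ b + 1 / N := min_le_right _ _
  have l1 := ico_bound α N hN a b ha hab.le hb
  have l2 := ico_bound α N hN a b' ha (by linarith) (min_le_left _ _)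
  have m1 : ((((Finset.Icc 1 N).filter (fun n : ℕ => a ≤ Int.fract (((n : ℝ) - α) ^ 2 / (2 * N)) ∧
        Int.fract (((n : ℝ) - α) ^ 2 / (2 * N)) < b)).card : ℕ) : ℝ) ≤ ((Finset.Icc 1 N).filter
            (fun n : ℕ => Int.fract (((n : ℝ) - α) ^ 2 / (2 * N)) ∈ Set.Icc a b)).card := by
    refine Nat.cast_le.2 (card_le_card fun n hn => ?_)
    obtain ⟨h0, h1, h2⟩ := mem_filter.1 hn
    exact mem_filter.2 ⟨h0, h1, h2.le⟩
  have m2 : ((((Finset.Icc 1 N).filter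
            (fun n : ℕ => Int.fract (((n : ℝ) - α) ^ 2 / (2 * N)) ∈ Set.Icc a b)).card : ℕ) : ℝ) ≤
      ((Finset.Icc 1 N).filter (fun n : ℕ => a ≤ Int.fract (((n : ℝ) - α) ^ 2 / (2 * N)) ∧
        Int.fract (((n : ℝ) - α) ^ 2 / (2 * N)) < b')).card := by
    refine Nat.cast_le.2 (card_le_card fun n hn => ?_)
    obtain ⟨h0, h1, h2⟩ := mem_filter.1 hn
    exact mem_filter.2 ⟨h0, h1, lt_min (Int.fract_lt_one _) (by linarith)⟩
  have l3 : N * (b' - a) ≤ N * (b - a) + 1 := by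
    have : (N:ℝ) * (b' - a) ≤ N * (b + 1 / N - a) := by gcongr
    have e : (N:ℝ) * (b + 1 / N - a) = N * (b - a) + 1 := by field_simp; ring
    linarith
  rw [abs_le] at l1 l2
  have e1 : 10 * Real.log N * (√(Real.log N) + (Nat.divisors N).card) / √N = 10 * R := by rw [hR]; ring
  rw [e1, abs_le]
  rw [le_sub_iff_add_le, sub_le_iff_le_add, le_div_iff₀ hN', div_le_iff₀ hN']
  constructor <;> linarith
end

section
/- Let α ∈ ℝ be Diophantine of type κ (i.e., there exists C > 0 with |α − p/q| > C/q^κ for all integers p and positive integers q), and let f : ℝ → ℝ be continuous, nonnegative, and rapidly decreasing. Then for fixed A > 1 and 0 < ε < 1/(κ−1), there exists k = k(A,κ,ε) such that uniformly for all D, T > 1: ∑_{d=1}^{D} ∑_{m∈ℤ} f(T(dα+m)) ≪ C_k T^{−A} if D ≤ T^ε; ≪ C₂ if T^ε ≤ D ≤ T^{1/(κ−1)}; and ≪ C₂ · D · T^{−1/(κ−1)} if D ≥ T^{1/(κ−1)}, where C_n = sup_{x∈ℝ} (1+|x|ⁿ)·f(x). -/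
open Finset

/-- `α` is Diophantine of type `κ` with constant `C`. -/
def DiophantineType (α : ℝ) (κ : ℝ) : Prop :=
  ∃ C : ℝ, 0 < C ∧ ∀ (p : ℤ) (q : ℕ), 0 < q → C / (q : ℝ) ^ κ < |α - p / q|

lemma dioph_linear {α κ C : ℝ}
    (hC : ∀ (p : ℤ) (q : ℕ), 0 < q → C / (q : ℝ) ^ κ < |α - p / q|)
    (q : ℕ) (hq : 0 < q) (p : ℤ) : C / (q : ℝ) ^ (κ - 1) ≤ |(q : ℝ) * α + p| := by
  have hq' : (0 : ℝ) < q := by exact_mod_cast hq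
  have h := hC (-p) q hq
  have e : |(q : ℝ) * α + p| = q * |α - ((-p : ℤ) : ℝ) / q| := by
    rw [← abs_of_pos hq', ← abs_mul, abs_of_pos hq']
    congr 1
    push_cast
    field_simp
    ring
  rw [e, Real.rpow_sub hq', Real.rpow_one]
  have e2 : C / ((q : ℝ) ^ κ / q) = q * (C / (q : ℝ) ^ κ) := by
    have := (Real.rpow_pos_of_pos hq' κ).ne'
    field_simp
  rw [e2]
  exact mul_le_mul_of_nonneg_left h.le hq'.le

/-- lower bound with `d ≤ P`, `P^(κ-1) ≤ M`. -/
lemma dioph_lower {α κ C T P M : ℝ} (hκ : 2 ≤ κ) (hC0 : 0 < C)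
    (hC : ∀ (p : ℤ) (q : ℕ), 0 < q → C / (q : ℝ) ^ κ < |α - p / q|)
    (hT : 1 < T) (hPM : P ^ (κ - 1) ≤ M)
    (q : ℕ) (hq : 0 < q) (hqP : (q : ℝ) ≤ P) (p : ℤ) :
    C * T / M ≤ |T * ((q : ℝ) * α + p)| := by
  have hq' : (0 : ℝ) < q := by exact_mod_cast hq
  have h := dioph_linear hC q hq p
  have h1 : (q : ℝ) ^ (κ - 1) ≤ M :=
    (Real.rpow_le_rpow hq'.le hqP (by linarith)).trans hPM
  have hp := Real.rpow_pos_of_pos hq' (κ - 1)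
  rw [abs_mul, abs_of_pos (by linarith : (0 : ℝ) < T)]
  calc C * T / M ≤ C * T / (q : ℝ) ^ (κ - 1) := by gcongr
    _ = T * (C / (q : ℝ) ^ (κ - 1)) := by ring
    _ ≤ _ := by gcongr

lemma summable_w : Summable (fun n : ℤ => 1 / (1 + (n : ℝ) ^ 2)) := by
  have h : Summable (fun n : ℤ => 1 / (n : ℝ) ^ 2) :=
    Real.summable_one_div_int_pow.mpr (by norm_num)
  refine Summable.of_norm_bounded_eventually h ?_
  rw [Filter.eventually_cofinite]
  refine (Set.finite_singleton (0 : ℤ)).subset ?_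
  intro n hn
  by_contra h0
  apply hn
  have h0' : (n : ℝ) ≠ 0 := by exact_mod_cast h0
  rw [Real.norm_of_nonneg (by positivity)]
  gcongr
  linarith

lemma block_bound {α κ C T : ℝ} (hκ : 2 ≤ κ) (hC0 : 0 < C)
    (hC : ∀ (p : ℤ) (q : ℕ), 0 < q → C / (q : ℝ) ^ κ < |α - p / q|)
    (hT : 1 < T) (S : Finset ℕ)
    (hS : ∀ a ∈ S, ∀ b ∈ S, a < b → ((b - a : ℕ) : ℝ) ≤ T ^ (1 / (κ - 1)))
    (f : ℝ → ℝ) (B : ℝ) (hf : ∀ x, 0 ≤ f x) (hB : 0 ≤ B)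
    (hfB : ∀ d ∈ S, ∀ m : ℤ, (1 + (T * ((d : ℝ) * α + m)) ^ 2) * f (T * ((d : ℝ) * α + m)) ≤ B) :
    ∑ d ∈ S, ∑' m : ℤ, f (T * ((d : ℝ) * α + m))
      ≤ (3 / (min C 1) ^ 2 * ∑' n : ℤ, 1 / (1 + (n : ℝ) ^ 2)) * B := by
  set s := min C 1 with hs
  have hs0 : 0 < s := lt_min hC0 one_pos
  have hs1 : s ≤ 1 := min_le_right _ _
  have hsC : s ≤ C := min_le_left _ _
  let x : S × ℤ → ℝ := fun z => T * (((z.1 : ℕ) : ℝ) * α + z.2)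
  let φ : S × ℤ → ℤ := fun z => ⌊x z / s⌋
  have hT0 : 0 < T := by linarith
  have key : ∀ a ∈ S, ∀ b ∈ S, a < b → ∀ m n : ℤ,
      s ≤ |T * ((b : ℝ) * α + n) - T * ((a : ℝ) * α + m)| := by
    intro a ha b hb hab m n
    have h := dioph_lower (α := α) (P := T ^ (1 / (κ - 1))) (M := T) hκ hC0 hC hT
      (by rw [← Real.rpow_mul hT0.le, one_div_mul_cancel (by linarith), Real.rpow_one])
      (b - a) (by omega) (hS a ha b hb hab) (n - m)
    rw [mul_div_assoc, div_self hT0.ne', mul_one] at h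
    refine (hsC.trans h).trans (le_of_eq ?_)
    congr 1
    rw [Nat.cast_sub hab.le]
    push_cast
    ring
  have sep : ∀ z w : S × ℤ, z ≠ w → s ≤ |x z - x w| := by
    rintro ⟨⟨a, ha⟩, m⟩ ⟨⟨b, hb⟩, n⟩ hne
    rcases lt_trichotomy a b with h | h | h
    · rw [abs_sub_comm]; exact key a ha b hb h m n
    · subst h
      have hmn : m - n ≠ 0 := by
        intro h0
        apply hne
        have : m = n := by omega
        rw [this]
      have h1 : (1 : ℝ) ≤ |((m - n : ℤ) : ℝ)| := by
        exact_mod_cast Int.one_le_abs hmn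
      have e : x (⟨a, ha⟩, m) - x (⟨a, hb⟩, n) = T * ((m - n : ℤ) : ℝ) := by
        simp only [x]; push_cast; ring
      rw [e, abs_mul, abs_of_pos hT0]
      nlinarith
    · exact key b hb a ha h n m
  have hφ : Function.Injective φ := by
    intro z w hzw
    by_contra hne
    have h1 := sep z w hne
    have h2 := Int.abs_sub_lt_one_of_floor_eq_floor hzw
    rw [← sub_div, abs_div, abs_of_pos hs0, div_lt_one hs0] at h2
    linarith
  have hsum : Summable (fun z : S × ℤ => 1 / (1 + (φ z : ℝ) ^ 2)) :=
    summable_w.comp_injective hφ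
  have hw : ∑' z : S × ℤ, 1 / (1 + (φ z : ℝ) ^ 2) ≤ ∑' n : ℤ, 1 / (1 + (n : ℝ) ^ 2) :=
    hsum.tsum_le_tsum_of_inj φ hφ (fun c _ => by positivity) (fun _ => le_rfl) summable_w
  have hpt : ∀ z : S × ℤ, f (x z) ≤ 3 / s ^ 2 * B * (1 / (1 + (φ z : ℝ) ^ 2)) := by
    intro z
    have h1 := hfB z.1 z.1.2 z.2
    change (1 + (x z) ^ 2) * f (x z) ≤ B at h1
    have hl : (φ z : ℝ) ≤ x z / s := Int.floor_le _
    have hu : x z / s < φ z + 1 := Int.lt_floor_add_one _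
    have h2 : (1 + (φ z : ℝ) ^ 2) ≤ 3 / s ^ 2 * (1 + (x z) ^ 2) := by
      have hx : x z = s * (x z / s) := by field_simp
      set y := x z / s with hy
      have : (φ z : ℝ) ^ 2 ≤ 2 * y ^ 2 + 2 := by nlinarith [sq_nonneg (y + (φ z - y)), sq_nonneg (y - (φ z - y))]
      rw [hx]
      have e : 3 / s ^ 2 * (1 + (s * y) ^ 2) = 3 / s ^ 2 + 3 * y ^ 2 := by field_simp
      have h3 : 3 ≤ 3 / s ^ 2 := by
        rw [le_div_iff₀ (by positivity)]; nlinarith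
      rw [e]; nlinarith [sq_nonneg y]
    rw [mul_one_div, le_div_iff₀ (by positivity)]
    calc f (x z) * (1 + (φ z : ℝ) ^ 2) ≤ f (x z) * (3 / s ^ 2 * (1 + (x z) ^ 2)) :=
          mul_le_mul_of_nonneg_left h2 (hf _)
      _ = 3 / s ^ 2 * ((1 + (x z) ^ 2) * f (x z)) := by ring
      _ ≤ 3 / s ^ 2 * B := by gcongr
  have hfs : Summable (fun z : S × ℤ => f (x z)) :=
    Summable.of_nonneg_of_le (fun z => hf _) hpt (hsum.mul_left _)
  have e : ∑ d ∈ S, ∑' m : ℤ, f (T * ((d : ℝ) * α + m)) = ∑' z : S × ℤ, f (x z) := by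
    rw [hfs.tsum_prod, tsum_fintype]
    exact (Finset.sum_coe_sort S (fun d => ∑' m : ℤ, f (T * ((d : ℝ) * α + m)))).symm
  rw [e]
  have h5 := hfs.tsum_le_tsum hpt (hsum.mul_left _)
  rw [tsum_mul_left] at h5
  refine h5.trans ?_
  calc _ ≤ 3 / s ^ 2 * B * ∑' n : ℤ, 1 / (1 + (n : ℝ) ^ 2) := by gcongr
    _ = _ := by ring

/-- Marklof's counting lemma (Lemma 6.6 of [Marklof]): bounds for
`∑_{d=1}^D ∑_{m∈ℤ} f(T(dα+m))` in three ranges of `D` relative to `T`. -/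
theorem marklof_counting_lemma (α κ : ℝ) (hκ : 2 ≤ κ) (hα : DiophantineType α κ)
    (A ε : ℝ) (hA : 1 < A) (hε0 : 0 < ε) (hε : ε < 1 / (κ - 1)) :
    ∃ k : ℕ, ∃ c : ℝ, 0 < c ∧
      ∀ (f : ℝ → ℝ), Continuous f → (∀ x, 0 ≤ f x) →
      ∀ (Cf : ℕ → ℝ), (∀ n x, (1 + |x| ^ n) * f x ≤ Cf n) →
      ∀ (D : ℕ) (T : ℝ), 1 < (D : ℝ) → 1 < T →
        (((D : ℝ) ≤ T ^ ε →
            ∑ d ∈ Finset.Icc 1 D, ∑' m : ℤ, f (T * ((d : ℝ) * α + m))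
              ≤ c * Cf k * T ^ (-A))
        ∧ (T ^ ε ≤ (D : ℝ) → (D : ℝ) ≤ T ^ (1 / (κ - 1)) →
            ∑ d ∈ Finset.Icc 1 D, ∑' m : ℤ, f (T * ((d : ℝ) * α + m))
              ≤ c * Cf 2)
        ∧ (T ^ (1 / (κ - 1)) ≤ (D : ℝ) →
            ∑ d ∈ Finset.Icc 1 D, ∑' m : ℤ, f (T * ((d : ℝ) * α + m))
              ≤ c * Cf 2 * D * T ^ (-(1 / (κ - 1))))) := by
  obtain ⟨C, hC0, hC⟩ := hα
  set K : ℝ := 3 / (min C 1) ^ 2 * ∑' n : ℤ, 1 / (1 + (n : ℝ) ^ 2) with hK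
  have hK0 : 0 < K := by
    have h1 : 0 < ∑' n : ℤ, 1 / (1 + (n : ℝ) ^ 2) :=
      summable_w.tsum_pos (fun n => by positivity) 0 (by norm_num)
    have h2 : 0 < min C 1 := lt_min hC0 one_pos
    positivity
  have hk1 : 0 < κ - 1 := by linarith
  set δ : ℝ := 1 - ε * (κ - 1) with hδ
  have hδ0 : 0 < δ := by
    rw [lt_div_iff₀ hk1] at hε; linarith
  obtain ⟨j, hj⟩ := exists_nat_ge (A / δ)
  have hjA : A ≤ δ * j := by
    rw [div_le_iff₀ hδ0] at hj; linarith
  set c1 : ℝ := (1 + 1 / C ^ 2) / C ^ j with hc1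
  have hc10 : 0 < c1 := by positivity
  refine ⟨j + 2, K * c1 + 3 * K, by positivity, ?_⟩
  intro f _ hf Cf hCf D T hD hT
  have hT0 : 0 < T := by linarith
  have hCf0 : ∀ n, 0 ≤ Cf n := fun n =>
    le_trans (mul_nonneg (by positivity) (hf 0)) (hCf n 0)
  have hC2 : ∀ x, (1 + x ^ 2) * f x ≤ Cf 2 := by
    intro x; have := hCf 2 x; rwa [sq_abs] at this
  have diff : ∀ P : ℝ, (D : ℝ) ≤ P → ∀ a ∈ Finset.Icc 1 D, ∀ b ∈ Finset.Icc 1 D, a < b →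
      ((b - a : ℕ) : ℝ) ≤ P := by
    intro P hP a ha b hb hab
    refine le_trans ?_ hP
    rw [Finset.mem_Icc] at hb
    exact_mod_cast (Nat.sub_le b a).trans hb.2
  refine ⟨?_, ?_, ?_⟩
  · intro hDε
    have hTA : 0 < T ^ (-A) := Real.rpow_pos_of_pos hT0 _
    have hB0 : 0 ≤ c1 * Cf (j + 2) * T ^ (-A) :=
      mul_nonneg (mul_nonneg hc10.le (hCf0 _)) hTA.le
    have hDP : (D : ℝ) ≤ T ^ (1 / (κ - 1)) :=
      hDε.trans (Real.rpow_le_rpow_of_exponent_le hT.le hε.le)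
    have h := block_bound hκ hC0 hC hT (Finset.Icc 1 D) (diff _ hDP) f
      (c1 * Cf (j + 2) * T ^ (-A)) hf hB0 ?_
    · refine h.trans ?_
      rw [← hK]
      have h3 : 0 ≤ 3 * K * (Cf (j + 2) * T ^ (-A)) :=
        mul_nonneg (by positivity) (mul_nonneg (hCf0 _) hTA.le)
      nlinarith
    · intro d hd m
      rw [Finset.mem_Icc] at hd
      have hx := dioph_lower (α := α) (P := T ^ ε) (M := T ^ (ε * (κ - 1))) hκ hC0 hC hT
        (by rw [← Real.rpow_mul hT0.le]) d (by omega)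
        (le_trans (by exact_mod_cast hd.2) hDε) m
      set x := T * ((d : ℝ) * α + m) with hxdef
      have eR : C * T / T ^ (ε * (κ - 1)) = C * T ^ δ := by
        rw [hδ, Real.rpow_sub hT0, Real.rpow_one]; ring
      rw [eR] at hx
      have hTδ : 1 ≤ T ^ δ := Real.one_le_rpow hT.le hδ0.le
      have hxC : C ≤ |x| := le_trans (by nlinarith) hx
      have hpow : C ^ j * T ^ A ≤ |x| ^ j := by
        calc C ^ j * T ^ A ≤ C ^ j * T ^ (δ * j) := by
              gcongr
              exact hT.le
          _ = (C * T ^ δ) ^ j := by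
              rw [mul_pow, Real.rpow_mul hT0.le, Real.rpow_natCast]
          _ ≤ |x| ^ j := by gcongr
      have h1 : |x| ^ (j + 2) * f x ≤ Cf (j + 2) := by
        have := hCf (j + 2) x
        nlinarith [hf x]
      have hTA' : 0 < T ^ A := Real.rpow_pos_of_pos hT0 _
      have h2 : x ^ 2 * f x ≤ Cf (j + 2) / (C ^ j * T ^ A) := by
        rw [le_div_iff₀ (by positivity)]
        calc x ^ 2 * f x * (C ^ j * T ^ A) ≤ x ^ 2 * f x * |x| ^ j :=
              mul_le_mul_of_nonneg_left hpow (mul_nonneg (sq_nonneg _) (hf x))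
          _ = |x| ^ (j + 2) * f x := by rw [pow_add, sq_abs]; ring
          _ ≤ _ := h1
      have h3 : 1 + x ^ 2 ≤ (1 + 1 / C ^ 2) * x ^ 2 := by
        have : C ^ 2 ≤ x ^ 2 := by
          rw [← sq_abs x]; gcongr
        have : 1 ≤ x ^ 2 / C ^ 2 := by rwa [le_div_iff₀ (by positivity), one_mul]
        calc 1 + x ^ 2 ≤ x ^ 2 / C ^ 2 + x ^ 2 := by linarith
          _ = _ := by ring
      calc (1 + x ^ 2) * f x ≤ (1 + 1 / C ^ 2) * x ^ 2 * f x :=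
            mul_le_mul_of_nonneg_right h3 (hf x)
        _ = (1 + 1 / C ^ 2) * (x ^ 2 * f x) := by ring
        _ ≤ (1 + 1 / C ^ 2) * (Cf (j + 2) / (C ^ j * T ^ A)) := by gcongr
        _ = c1 * Cf (j + 2) * T ^ (-A) := by
            rw [Real.rpow_neg hT0.le, hc1]; field_simp
  · intro _ hDP
    have h := block_bound hκ hC0 hC hT (Finset.Icc 1 D) (diff _ hDP) f (Cf 2) hf (hCf0 2)
      (fun d _ m => hC2 _)
    refine h.trans ?_
    rw [← hK]
    have h3 : 0 ≤ K * Cf 2 := mul_nonneg hK0.le (hCf0 2)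
    have h4 : 0 ≤ K * c1 * Cf 2 := mul_nonneg (by positivity) (hCf0 2)
    nlinarith
  · intro hPD
    set P : ℝ := T ^ (1 / (κ - 1)) with hP
    have hP1 : 1 ≤ P := Real.one_le_rpow hT.le (by positivity)
    set L : ℕ := ⌊P⌋₊ with hL
    have hL1 : 1 ≤ L := Nat.le_floor (by exact_mod_cast hP1)
    have hLP : (L : ℝ) ≤ P := Nat.floor_le (by linarith)
    have hPL : P < L + 1 := Nat.lt_floor_add_one P
    have hL1' : (1 : ℝ) ≤ L := by exact_mod_cast hL1
    have hmaps : ∀ d ∈ Finset.Icc 1 D, d / L ∈ Finset.range (D / L + 1) := by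
      intro d hd
      rw [Finset.mem_Icc] at hd
      rw [Finset.mem_range]
      exact Nat.lt_succ_of_le (Nat.div_le_div_right hd.2)
    rw [← Finset.sum_fiberwise_of_maps_to hmaps]
    have hblock : ∀ i ∈ Finset.range (D / L + 1),
        ∑ d ∈ Finset.Icc 1 D with d / L = i, ∑' m : ℤ, f (T * ((d : ℝ) * α + m)) ≤ K * Cf 2 := by
      intro i _
      refine block_bound hκ hC0 hC hT _ ?_ f (Cf 2) hf (hCf0 2) (fun d _ m => hC2 _)
      intro a ha b hb hab
      rw [Finset.mem_filter] at ha hb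
      have h1 := Nat.div_add_mod a L
      have h2 := Nat.div_add_mod b L
      rw [ha.2] at h1
      rw [hb.2] at h2
      have h3 := Nat.mod_lt b hL1
      have h4 : b - a ≤ L := by omega
      exact le_trans (by exact_mod_cast h4) hLP
    have hs := Finset.sum_le_card_nsmul _ _ _ hblock
    refine hs.trans ?_
    rw [Finset.card_range, nsmul_eq_mul, Real.rpow_neg hT0.le, ← hP]
    have hcount : ((D / L + 1 : ℕ) : ℝ) ≤ 3 * D * P⁻¹ := by
      push_cast
      have h1 : ((D / L : ℕ) : ℝ) ≤ D / L := Nat.cast_div_le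
      have h2 : (D : ℝ) / L ≤ 2 * D * P⁻¹ := by
        rw [← div_eq_mul_inv, div_le_div_iff₀ (by linarith) (by linarith)]
        nlinarith
      have h3 : 1 ≤ D * P⁻¹ := by
        rw [← div_eq_mul_inv, le_div_iff₀ (by linarith)]; linarith
      linarith
    have h3 : 0 ≤ K * Cf 2 := mul_nonneg hK0.le (hCf0 2)
    have h4 : 0 ≤ K * c1 * Cf 2 * (D * P⁻¹) :=
      mul_nonneg (mul_nonneg (by positivity) (hCf0 2)) (by positivity)
    calc ((D / L + 1 : ℕ) : ℝ) * (K * Cf 2) ≤ 3 * D * P⁻¹ * (K * Cf 2) := by gcongr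
      _ ≤ _ := by nlinarith
end
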